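/- arXiv:2104.14705 — 2 statements merged into one kernel-verified Lean document; each statement's English description precedes it below -/
import Mathlib

section
/- For every x ∈ ℂ with x ∉ Λ one has ℘'(x|τ) = − θ₁'(τ)³ · θ₁(2x|τ) / θ₁(x|τ)⁴, where ℘' denotes the derivative of ℘ in z. -/
noncomputable section

open Complex

namespace Liu

/-- `π` as a complex number. -/
def piC : ℂ := Real.pi

/-- The nome `q = exp(2πiτ)`. -/
def qq (τ : ℂ) : ℂ := exp (2 * piC * I * τ)

/-- Jacobi theta function θ₁(z|τ). -/
def theta1 (z τ : ℂ) : ℂ :=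
  -I * exp (piC * I * τ / 4) *
    ∑' n : ℤ, (-1 : ℂ) ^ n * exp (piC * I * τ * (n : ℂ) * ((n : ℂ) + 1)) *
      exp ((2 * (n : ℂ) + 1) * I * z)

/-- Jacobi theta function θ₂(z|τ). -/
def theta2 (z τ : ℂ) : ℂ :=
  2 * ∑' n : ℕ, exp (piC * I * τ * (2 * (n : ℂ) + 1) ^ 2 / 4) * cos ((2 * (n : ℂ) + 1) * z)

/-- Jacobi theta function θ₃(z|τ). -/
def theta3 (z τ : ℂ) : ℂ :=
  1 + 2 * ∑' n : ℕ, exp (piC * I * τ * ((n : ℂ) + 1) ^ 2) * cos (2 * ((n : ℂ) + 1) * z)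

/-- Jacobi theta function θ₄(z|τ). -/
def theta4 (z τ : ℂ) : ℂ :=
  1 + 2 * ∑' n : ℕ, (-1 : ℂ) ^ (n + 1) * exp (piC * I * τ * ((n : ℂ) + 1) ^ 2) *
    cos (2 * ((n : ℂ) + 1) * z)

/-- θ₁'(τ) = (∂θ₁/∂z)(0|τ). -/
def theta1' (τ : ℂ) : ℂ := deriv (fun z => theta1 z τ) 0

/-- The Dedekind eta function. -/
def eta (τ : ℂ) : ℂ := exp (piC * I * τ / 12) * ∏' n : ℕ, (1 - qq τ ^ (n + 1))

/-- Eisenstein series L = E₂. -/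
def EisL (τ : ℂ) : ℂ :=
  1 - 24 * ∑' n : ℕ, ((n : ℂ) + 1) * qq τ ^ (n + 1) / (1 - qq τ ^ (n + 1))

/-- Eisenstein series M = E₄. -/
def EisM (τ : ℂ) : ℂ :=
  1 + 240 * ∑' n : ℕ, ((n : ℂ) + 1) ^ 3 * qq τ ^ (n + 1) / (1 - qq τ ^ (n + 1))

/-- The period lattice Λ = {mπ + nπτ : m, n ∈ ℤ}. -/
def Lambda (τ : ℂ) : Set ℂ := {z | ∃ m n : ℤ, z = (m : ℂ) * piC + (n : ℂ) * piC * τ}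

/-- The Weierstrass ℘ function attached to the lattice with periods π and πτ. -/
def wp (τ z : ℂ) : ℂ :=
  1 / z ^ 2 + ∑' p : ℤ × ℤ,
    if p = (0, 0) then 0
    else 1 / (z - ((p.1 : ℂ) * piC + (p.2 : ℂ) * piC * τ)) ^ 2
      - 1 / ((p.1 : ℂ) * piC + (p.2 : ℂ) * piC * τ) ^ 2

/-- The `n`-th Fourier coefficient (up to the factor `π`) of a `π`-periodic function. -/
def fourierInt (f : ℂ → ℂ) (n : ℤ) : ℂ :=
  ∫ x in (0 : ℝ)..Real.pi, f x * exp (-(2 * I * n * x))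

lemma intervalIntegral_add_of_periodic {g : ℂ → ℂ} (hg : Differentiable ℂ g)
    (hper : ∀ z, g (z + Real.pi) = g z) (s : ℂ) :
    ∫ x in (0 : ℝ)..Real.pi, g (x + s) = ∫ x in (0 : ℝ)..Real.pi, g x := by
  have h1 := integral_boundary_rect_eq_zero_of_differentiableOn g 0 (Real.pi + s.im * I)
    hg.differentiableOn
  simp only [zero_re, zero_im, add_re, ofReal_re, mul_re, I_re, mul_zero, ofReal_im, I_im,
    mul_one, sub_self, add_zero, add_im, mul_im, zero_add, ofReal_zero, zero_mul,
    smul_eq_mul] at h1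
  have h2 : ∀ y : ℝ, g (Real.pi + y * I) = g (y * I) := fun y => by rw [add_comm, hper]
  simp only [h2, add_sub_cancel_right, sub_eq_zero] at h1
  rw [h1]
  have hp : Function.Periodic (fun x : ℝ => g (x + s.im * I)) Real.pi := fun x => by
    simp only
    rw [← hper (x + s.im * I)]
    push_cast
    ring_nf
  have h3 := hp.intervalIntegral_add_eq s.re 0
  rw [zero_add] at h3
  rw [← h3, add_comm s.re]
  have h4 := intervalIntegral.integral_comp_add_right (a := 0) (b := Real.pi)
    (fun x : ℝ => g (x + s.im * I)) s.re
  rw [zero_add] at h4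
  rw [← h4]
  congr 1
  ext x
  push_cast
  rw [add_assoc, re_add_im]

lemma eq_zero_of_fourierInt_eq_zero {f : ℂ → ℂ} (hf : Differentiable ℂ f)
    (hper : ∀ z, f (z + Real.pi) = f z) (h0 : ∀ n, fourierInt f n = 0) : f = 0 := by
  have : Fact (0 < Real.pi) := ⟨Real.pi_pos⟩
  have hp : Function.Periodic (fun x : ℝ => f x) Real.pi := fun x => by
    simp only; push_cast; exact hper x
  have hc : Continuous (fun x : ℝ => f x) := hf.continuous.comp continuous_ofReal
  let F : C(AddCircle Real.pi, ℂ) := ⟨hp.lift, continuous_coinduced_dom.mpr hc⟩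
  have hF : ∀ x : ℝ, F x = f x := fun x => rfl
  have hcoef : fourierCoeff F = 0 := by
    ext n
    rw [fourierCoeff_eq_intervalIntegral _ n 0, zero_add]
    have : ∫ x in (0 : ℝ)..Real.pi, fourier (-n) (x : AddCircle Real.pi) • F x
        = fourierInt f n := by
      rw [fourierInt]
      congr 1
      ext x
      rw [hF, fourier_coe_apply, smul_eq_mul, mul_comm]
      congr 2
      have : (Real.pi : ℂ) ≠ 0 := ofReal_ne_zero.mpr Real.pi_ne_zero
      push_cast
      field_simp
    rw [this, h0]
    simp
  have hreal : ∀ x : ℝ, f x = 0 := fun x => by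
    have h := has_pointwise_sum_fourier_series_of_summable (f := F)
      (by rw [hcoef]; exact summable_zero) (x : AddCircle Real.pi)
    rw [hcoef, hF] at h
    simp only [Pi.zero_apply, zero_smul] at h
    exact h.unique hasSum_zero
  have han : AnalyticOnNhd ℂ f Set.univ := hf.differentiableOn.analyticOnNhd isOpen_univ
  have hfreq : ∃ᶠ z in nhdsWithin (0 : ℂ) {0}ᶜ, f z = 0 := by
    have ht : Filter.Tendsto (fun x : ℝ => (x : ℂ)) (nhdsWithin 0 {0}ᶜ)
        (nhdsWithin (0 : ℂ) {0}ᶜ) := by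
      refine tendsto_nhdsWithin_iff.mpr ⟨?_, ?_⟩
      · exact (continuous_ofReal.tendsto' 0 0 ofReal_zero).mono_left nhdsWithin_le_nhds
      · filter_upwards [self_mem_nhdsWithin] with x hx
        simpa using hx
    exact ht.frequently (Filter.Frequently.of_forall hreal)
  ext z
  exact han.eqOn_zero_of_preconnected_of_frequently_eq_zero isPreconnected_univ
    (Set.mem_univ 0) hfreq (Set.mem_univ z)

/-- Entire odd functions with the quasi-periodicity of the fourth power of `θ₁`. -/
structure IsOddQuartic (τ : ℂ) (f : ℂ → ℂ) : Prop where
  differentiable : Differentiable ℂ f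
  neg : ∀ z, f (-z) = -f z
  add_pi : ∀ z, f (z + Real.pi) = f z
  add_pi_mul : ∀ z, f (z + Real.pi * τ) =
    exp (-(4 * Real.pi * I * τ)) * exp (-(8 * I * z)) * f z

namespace IsOddQuartic

variable {τ : ℂ} {f g : ℂ → ℂ}

lemma fourierInt_add_four (hf : IsOddQuartic τ f) (n : ℤ) :
    fourierInt f n =
      exp (-(4 * Real.pi * I * τ) - 2 * Real.pi * I * n * τ) * fourierInt f (n + 4) := by
  have hd : Differentiable ℂ fun z => f z * exp (-(2 * I * n * z)) :=
    hf.differentiable.mul (by fun_prop)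
  have hper : ∀ z, f (z + Real.pi) * exp (-(2 * I * n * (z + Real.pi))) =
      f z * exp (-(2 * I * n * z)) := fun z => by
    rw [hf.add_pi]
    congr 1
    rw [exp_eq_exp_iff_exists_int]
    exact ⟨-n, by push_cast; ring⟩
  have h := intervalIntegral_add_of_periodic hd hper (Real.pi * τ)
  rw [fourierInt, ← h, fourierInt, ← intervalIntegral.integral_const_mul]
  congr 1
  ext x
  rw [hf.add_pi_mul, mul_right_comm, ← exp_add, ← exp_add, mul_left_comm, ← exp_add,
    mul_comm (f x)]
  congr 2
  push_cast
  ring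

lemma fourierInt_neg (hf : IsOddQuartic τ f) (n : ℤ) :
    fourierInt f (-n) = -fourierInt f n := by
  have hp : Function.Periodic (fun x : ℝ => f x * exp (-(2 * I * n * x))) Real.pi := fun x => by
    simp only
    push_cast
    rw [hf.add_pi]
    congr 1
    rw [exp_eq_exp_iff_exists_int]
    exact ⟨-n, by push_cast; ring⟩
  have h1 := hp.intervalIntegral_add_eq (-Real.pi) 0
  have h2 := intervalIntegral.integral_comp_neg (a := 0) (b := Real.pi)
    (fun x : ℝ => f x * exp (-(2 * I * n * x)))
  rw [neg_add_cancel, zero_add] at h1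
  rw [neg_zero, h1] at h2
  rw [fourierInt, fourierInt, ← h2, ← intervalIntegral.integral_neg]
  congr 1
  ext x
  push_cast
  rw [hf.neg]
  ring_nf

lemma fourierInt_add_four_mul (hf : IsOddQuartic τ f) (n k : ℤ) (h : fourierInt f n = 0) :
    fourierInt f (n + 4 * k) = 0 := by
  induction k with
  | zero => simpa using h
  | succ k ih =>
    rw [hf.fourierInt_add_four, mul_eq_zero, or_iff_right (exp_ne_zero _)] at ih
    rwa [mul_add, mul_one, ← add_assoc]
  | pred k ih =>
    rw [hf.fourierInt_add_four, mul_eq_zero]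
    right
    rw [← ih]
    congr 1
    ring

lemma eq_zero (hf : IsOddQuartic τ f) (h1 : fourierInt f 1 = 0) : f = 0 := by
  have h0 : fourierInt f 0 = 0 := by
    have := hf.fourierInt_neg 0
    rwa [neg_zero, self_eq_neg] at this
  have h2 : fourierInt f 2 = 0 := by
    have h := hf.fourierInt_add_four (-2)
    rw [hf.fourierInt_neg, show -(4 * Real.pi * I * τ) - 2 * Real.pi * I * ((-2 : ℤ) : ℂ) * τ = 0 by
      push_cast; ring, exp_zero, one_mul, show (-2 + 4 : ℤ) = 2 by norm_num] at h
    exact neg_eq_self.mp h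
  have h3 : fourierInt f (-1) = 0 := by rw [hf.fourierInt_neg, h1, neg_zero]
  refine eq_zero_of_fourierInt_eq_zero hf.differentiable hf.add_pi fun n => ?_
  obtain ⟨k, rfl | rfl | rfl | rfl⟩ :
      ∃ k : ℤ, n = 0 + 4 * k ∨ n = 1 + 4 * k ∨ n = 2 + 4 * k ∨ n = -1 + 4 * k :=
    ⟨(n + 1) / 4, by omega⟩
  all_goals exact hf.fourierInt_add_four_mul _ _ (by assumption)

lemma add (hf : IsOddQuartic τ f) (hg : IsOddQuartic τ g) :
    IsOddQuartic τ fun z => f z + g z where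
  differentiable := hf.differentiable.add hg.differentiable
  neg z := by rw [hf.neg, hg.neg]; ring
  add_pi z := by rw [hf.add_pi, hg.add_pi]
  add_pi_mul z := by rw [hf.add_pi_mul, hg.add_pi_mul]; ring

lemma const_mul (c : ℂ) (hf : IsOddQuartic τ f) : IsOddQuartic τ fun z => c * f z where
  differentiable := hf.differentiable.const_mul c
  neg z := by rw [hf.neg]; ring
  add_pi z := by rw [hf.add_pi]
  add_pi_mul z := by rw [hf.add_pi_mul]; ring

lemma fourierInt_add_const_mul (hf : IsOddQuartic τ f) (hg : IsOddQuartic τ g) (c : ℂ) (n : ℤ) :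
    fourierInt (fun z => f z + c * g z) n = fourierInt f n + c * fourierInt g n := by
  have hi : ∀ {h : ℂ → ℂ}, IsOddQuartic τ h → IntervalIntegrable
      (fun x : ℝ => h x * exp (-(2 * I * n * x))) MeasureTheory.volume 0 Real.pi := fun hh => by
    refine Continuous.intervalIntegrable ?_ _ _
    exact (hh.differentiable.continuous.comp continuous_ofReal).mul (by fun_prop)
  rw [fourierInt, fourierInt, fourierInt, ← intervalIntegral.integral_const_mul,
    ← intervalIntegral.integral_add (hi hf) ((hi hg).const_mul c)]
  congr 1
  ext x
  ring

lemma exists_eq_const_mul (hf : IsOddQuartic τ f) (hg : IsOddQuartic τ g) (hg0 : g ≠ 0) :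
    ∃ c : ℂ, ∀ z, f z = c * g z := by
  have h1 : fourierInt g 1 ≠ 0 := fun h => hg0 (hg.eq_zero h)
  refine ⟨fourierInt f 1 / fourierInt g 1, fun z => ?_⟩
  have h := (hf.add (hg.const_mul (-(fourierInt f 1 / fourierInt g 1)))).eq_zero (by
    rw [fourierInt_add_const_mul hf hg]
    field_simp
    ring)
  have := congrFun h z
  simp only [Pi.zero_apply] at this
  linear_combination this

end IsOddQuartic

section Theta

variable {τ : ℂ}

lemma theta1_eq_jacobiTheta₂ (z τ : ℂ) :
    theta1 z τ = -I * exp (Real.pi * I * τ / 4) * exp (I * z) *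
      jacobiTheta₂ (z / Real.pi + 1 / 2 + τ / 2) τ := by
  have hpi : (Real.pi : ℂ) ≠ 0 := ofReal_ne_zero.mpr Real.pi_ne_zero
  rw [theta1, piC, jacobiTheta₂, mul_assoc _ (exp (I * z))]
  congr 1
  rw [← tsum_mul_left]
  refine tsum_congr fun n => ?_
  have h1 : (-1 : ℂ) ^ n = exp (n * (Real.pi * I)) := by
    rw [exp_int_mul, exp_pi_mul_I]
  rw [jacobiTheta₂_term, h1, ← exp_add, ← exp_add, ← exp_add]
  congr 1
  field_simp
  ring

lemma differentiable_theta1 (hτ : 0 < τ.im) : Differentiable ℂ fun z => theta1 z τ := by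
  simp only [theta1_eq_jacobiTheta₂]
  intro z
  have h : DifferentiableAt ℂ (fun z : ℂ => jacobiTheta₂ (z / Real.pi + 1 / 2 + τ / 2) τ) z :=
    (differentiableAt_jacobiTheta₂_fst _ hτ).fun_comp' z (by fun_prop)
  fun_prop

lemma theta1_neg (z τ : ℂ) : theta1 (-z) τ = -theta1 z τ := by
  rw [theta1, theta1, ← mul_neg, ← tsum_neg,
    ← ((Equiv.neg ℤ).trans (Equiv.addRight (-1 : ℤ))).tsum_eq]
  congr 2
  ext n
  simp only [Equiv.trans_apply, Equiv.neg_apply, Equiv.coe_addRight]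
  have h1 : (-1 : ℂ) ^ (-n + -1) = -(-1) ^ n := by
    rw [zpow_add₀ (by norm_num), zpow_neg, ← inv_zpow]
    norm_num
  rw [h1]
  push_cast
  ring_nf

lemma theta1_add_pi (z τ : ℂ) : theta1 (z + Real.pi) τ = -theta1 z τ := by
  have hpi : (Real.pi : ℂ) ≠ 0 := ofReal_ne_zero.mpr Real.pi_ne_zero
  rw [theta1_eq_jacobiTheta₂, theta1_eq_jacobiTheta₂,
    show (z + Real.pi) / Real.pi + 1 / 2 + τ / 2 = (z / Real.pi + 1 / 2 + τ / 2) + 1 by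
      field_simp; ring,
    jacobiTheta₂_add_left, mul_add, exp_add, mul_comm I (Real.pi : ℂ), exp_pi_mul_I]
  ring

lemma theta1_add_pi_mul (z τ : ℂ) : theta1 (z + Real.pi * τ) τ =
    -(exp (-(Real.pi * I * τ)) * exp (-(2 * I * z))) * theta1 z τ := by
  have hpi : (Real.pi : ℂ) ≠ 0 := ofReal_ne_zero.mpr Real.pi_ne_zero
  rw [theta1_eq_jacobiTheta₂, theta1_eq_jacobiTheta₂,
    show (z + Real.pi * τ) / Real.pi + 1 / 2 + τ / 2 = (z / Real.pi + 1 / 2 + τ / 2) + τ by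
      field_simp; ring,
    jacobiTheta₂_add_left']
  have h : exp (I * (z + Real.pi * τ)) *
        exp (-Real.pi * I * (τ + 2 * (z / Real.pi + 1 / 2 + τ / 2))) =
      -(exp (-(Real.pi * I * τ)) * exp (-(2 * I * z))) * exp (I * z) := by
    trans exp (Real.pi * I) * (exp (-(Real.pi * I * τ)) * exp (-(2 * I * z)) * exp (I * z))
    · rw [← exp_add, ← exp_add, ← exp_add, ← exp_add, exp_eq_exp_iff_exists_int]
      exact ⟨-1, by push_cast; field_simp; ring⟩
    · rw [exp_pi_mul_I]
      ring
  linear_combination (-I * exp (Real.pi * I * τ / 4) *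
    jacobiTheta₂ (z / Real.pi + 1 / 2 + τ / 2) τ) * h

lemma theta1_zero (τ : ℂ) : theta1 0 τ = 0 := by
  have h := theta1_neg 0 τ
  rwa [neg_zero, self_eq_neg] at h

lemma theta1_add_pi_mul_eq_zero_iff (z τ : ℂ) :
    theta1 (z + Real.pi * τ) τ = 0 ↔ theta1 z τ = 0 := by
  rw [theta1_add_pi_mul, mul_eq_zero, or_iff_right
    (neg_ne_zero.mpr (mul_ne_zero (exp_ne_zero _) (exp_ne_zero _)))]

lemma theta1_add_lattice_eq_zero_iff (z τ : ℂ) (m n : ℤ) :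
    theta1 (z + (m * Real.pi + n * (Real.pi * τ))) τ = 0 ↔ theta1 z τ = 0 := by
  have h1 : Function.Periodic (fun z => theta1 z τ = 0) (Real.pi : ℂ) := fun z => by
    simp only [theta1_add_pi, neg_eq_zero]
  have h2 : Function.Periodic (fun z => theta1 z τ = 0) (Real.pi * τ : ℂ) := fun z => by
    simp only [theta1_add_pi_mul_eq_zero_iff]
  exact iff_of_eq (((h1.int_mul m).add_period (h2.int_mul n)) z)

lemma integral_jacobiTheta₂ (hτ : 0 < τ.im) :
    ∫ x in (0 : ℝ)..1, jacobiTheta₂ x τ = 1 := by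
  let f : ℤ → C(ℝ, ℂ) := fun n =>
    ⟨fun x => jacobiTheta₂_term n x τ, by unfold jacobiTheta₂_term; fun_prop⟩
  have hs : Summable fun n : ℤ =>
      ‖(f n).restrict (⟨Set.uIcc 0 1, isCompact_uIcc⟩ : TopologicalSpace.Compacts ℝ)‖ := by
    refine Summable.of_nonneg_of_le (fun _ => norm_nonneg _) (fun n => ?_)
      ((summable_jacobiTheta₂_term_iff 0 τ).mpr hτ).norm
    refine (ContinuousMap.norm_le _ (norm_nonneg _)).mpr fun x => ?_
    simp only [ContinuousMap.restrict_apply, f, ContinuousMap.coe_mk, norm_jacobiTheta₂_term,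
      ofReal_im, zero_im, le_refl]
  have h := intervalIntegral.hasSum_intervalIntegral_of_summable_norm hs
  refine h.unique ?_
  have hn : ∀ n : ℤ, n ≠ 0 → ∫ x in (0 : ℝ)..1, f n x = 0 := fun n hn => by
    have hc : (2 * Real.pi * I * n : ℂ) ≠ 0 := by
      simp [Real.pi_ne_zero, hn]
    simp only [f, ContinuousMap.coe_mk, jacobiTheta₂_term, exp_add]
    rw [intervalIntegral.integral_mul_const, integral_exp_mul_complex hc]
    have : (2 * Real.pi * I * n * (1 : ℝ) : ℂ) = n * (2 * Real.pi * I) := by push_cast; ring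
    rw [this, exp_int_mul_two_pi_mul_I]
    simp
  have h0 : ∫ x in (0 : ℝ)..1, f 0 x = 1 := by simp [f, jacobiTheta₂_term]
  rw [← h0]
  exact hasSum_single 0 hn

lemma exists_theta1_ne_zero (hτ : 0 < τ.im) : ∃ z, theta1 z τ ≠ 0 := by
  by_contra! h
  have hpi : (Real.pi : ℂ) ≠ 0 := ofReal_ne_zero.mpr Real.pi_ne_zero
  have h0 : ∀ w, jacobiTheta₂ w τ = 0 := fun w => by
    have := h (Real.pi * (w - 1 / 2 - τ / 2))
    rw [theta1_eq_jacobiTheta₂, mul_div_cancel_left₀ _ hpi,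
      show w - 1 / 2 - τ / 2 + 1 / 2 + τ / 2 = w by ring] at this
    simpa [exp_ne_zero] using this
  simpa [h0] using integral_jacobiTheta₂ hτ

lemma theta1_eventually_ne_zero (hτ : 0 < τ.im) (a : ℂ) :
    ∀ᶠ z in nhdsWithin a {a}ᶜ, theta1 z τ ≠ 0 := by
  have han : AnalyticOnNhd ℂ (fun z => theta1 z τ) Set.univ :=
    (differentiable_theta1 hτ).differentiableOn.analyticOnNhd isOpen_univ
  refine ((han a (Set.mem_univ a)).eventually_eq_zero_or_eventually_ne_zero).resolve_left
    fun h => ?_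
  obtain ⟨z, hz⟩ := exists_theta1_ne_zero hτ
  exact hz (han.eqOn_zero_of_preconnected_of_eventuallyEq_zero isPreconnected_univ
    (Set.mem_univ a) h (Set.mem_univ z))

lemma isOddQuartic_theta1_two_mul (hτ : 0 < τ.im) : IsOddQuartic τ fun z => theta1 (2 * z) τ where
  differentiable := (differentiable_theta1 hτ).comp (differentiable_id.const_mul 2)
  neg z := by rw [mul_neg, theta1_neg]
  add_pi z := by
    rw [mul_add, two_mul (Real.pi : ℂ), ← add_assoc, theta1_add_pi, theta1_add_pi, neg_neg]
  add_pi_mul z := by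
    rw [mul_add, two_mul (Real.pi * τ : ℂ), ← add_assoc, theta1_add_pi_mul, theta1_add_pi_mul,
      ← mul_assoc, neg_mul_neg, ← exp_add, ← exp_add, ← exp_add, ← exp_add]
    congr 2
    ring

end Theta

section Weierstrass

variable {τ : ℂ}

/-- The pair of periods `π`, `πτ`. -/
def periods (τ : ℂ) (hτ : 0 < τ.im) : PeriodPair where
  ω₁ := Real.pi
  ω₂ := Real.pi * τ
  indep := by
    rw [LinearIndependent.pair_iff]
    intro s t h
    have hre := congrArg re h
    have him := congrArg im h
    simp [Real.pi_ne_zero, hτ.ne'] at hre him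
    subst him
    simpa [Real.pi_ne_zero] using hre

lemma mem_periods_lattice (hτ : 0 < τ.im) (z : ℂ) :
    z ∈ (periods τ hτ).lattice ↔ z ∈ Lambda τ := by
  rw [PeriodPair.mem_lattice]
  refine exists_congr fun m => exists_congr fun n => ?_
  rw [eq_comm, mul_assoc (n : ℂ)]
  rfl

lemma wp_eq_weierstrassP (hτ : 0 < τ.im) : wp τ = (periods τ hτ).weierstrassP := by
  ext z
  have h := (periods τ hτ).weierstrassPExcept_add 0 z
  rw [← h, PeriodPair.weierstrassPExcept, ← (periods τ hτ).latticeEquivProd.symm.toEquiv.tsum_eq,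
    wp, add_comm]
  congr 1
  · refine tsum_congr fun p => ?_
    have hc : (((periods τ hτ).latticeEquivProd.symm p : (periods τ hτ).lattice) : ℂ) =
        p.1 * piC + p.2 * piC * τ := by
      rw [PeriodPair.latticeEquiv_symm_apply, mul_assoc]
      rfl
    have h0 : p = (0, 0) ↔
        (((periods τ hτ).latticeEquivProd.symm p : (periods τ hτ).lattice) : ℂ) = 0 := by
      rw [ZeroMemClass.coe_eq_zero, LinearEquiv.map_eq_zero_iff]
      rfl
    rw [hc] at h0
    simp only [LinearEquiv.coe_toEquiv, ZeroMemClass.coe_zero, hc, h0]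
  · simp

lemma pi_mem_lattice (hτ : 0 < τ.im) : (Real.pi : ℂ) ∈ (periods τ hτ).lattice :=
  (periods τ hτ).ω₁_mem_lattice

lemma pi_mul_mem_lattice (hτ : 0 < τ.im) : (Real.pi * τ : ℂ) ∈ (periods τ hτ).lattice :=
  (periods τ hτ).ω₂_mem_lattice

lemma theta1_eq_zero_of_sub_mem_lattice (hτ : 0 < τ.im) {b z : ℂ} (hb : theta1 b τ = 0)
    (hz : z - b ∈ (periods τ hτ).lattice) : theta1 z τ = 0 := by
  obtain ⟨m, n, h⟩ := PeriodPair.mem_lattice.mp hz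
  rw [← add_sub_cancel b z, ← h]
  exact (theta1_add_lattice_eq_zero_iff b τ m n).mpr hb

lemma exists_theta1_eq_sub_mul (hτ : 0 < τ.im) {a : ℂ} (ha : theta1 a τ = 0) :
    ∃ g : ℂ → ℂ, Differentiable ℂ g ∧ g a = deriv (fun z => theta1 z τ) a ∧
      ∀ z, theta1 z τ = (z - a) * g z := by
  refine ⟨dslope (fun z => theta1 z τ) a, ?_, dslope_same _ _, fun z => ?_⟩
  · rw [← differentiableOn_univ, differentiableOn_dslope Filter.univ_mem, differentiableOn_univ]
    exact differentiable_theta1 hτ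
  · rw [← smul_eq_mul, sub_smul_dslope, ha, sub_zero]

lemma differentiable_derivWeierstrassP_mul (hτ : 0 < τ.im) {b : ℂ} (hb : theta1 b τ = 0) :
    Differentiable ℂ fun z => (periods τ hτ).derivWeierstrassP (z - b) * theta1 z τ ^ 4 := by
  set L := periods τ hτ
  have hθ := differentiable_theta1 hτ
  intro c
  by_cases hc : c - b ∈ L.lattice
  · obtain ⟨g, hg, -, hgz⟩ := exists_theta1_eq_sub_mul hτ
      (theta1_eq_zero_of_sub_mem_lattice hτ hb hc)
    have heq : (fun z => L.derivWeierstrassP (z - b) * theta1 z τ ^ 4) = fun z =>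
        L.derivWeierstrassPExcept (c - b) (z - b) * theta1 z τ ^ 4 - 2 * (z - c) * g z ^ 4 := by
      ext z
      rw [← L.derivWeierstrassPExcept_sub ⟨c - b, hc⟩, hgz, sub_sub_sub_cancel_right]
      rcases eq_or_ne z c with rfl | hz
      · simp
      · have := sub_ne_zero.mpr hz
        field_simp
    rw [heq]
    have h1 : DifferentiableAt ℂ (fun z => L.derivWeierstrassPExcept (c - b) (z - b)) c :=
      (L.analyticAt_derivWeierstrassPExcept (c - b)).differentiableAt.fun_comp' c (by fun_prop)
    exact (h1.mul (hθ.pow 4 c)).sub (((differentiableAt_id.sub_const c).const_mul 2).mul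
      (hg.pow 4 c))
  · have h1 : DifferentiableAt ℂ (fun z => L.derivWeierstrassP (z - b)) c :=
      (L.analyticOnNhd_derivWeierstrassP (c - b) hc).differentiableAt.fun_comp' c (by fun_prop)
    exact h1.mul (hθ.pow 4 c)

lemma theta1_add_pi_mul_pow_four (z τ : ℂ) : theta1 (z + Real.pi * τ) τ ^ 4 =
    exp (-(4 * Real.pi * I * τ)) * exp (-(8 * I * z)) * theta1 z τ ^ 4 := by
  rw [theta1_add_pi_mul, mul_pow, neg_pow, mul_pow, ← exp_nat_mul, ← exp_nat_mul]
  push_cast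
  ring_nf

lemma isOddQuartic_derivWeierstrassP (hτ : 0 < τ.im) {b : ℂ} (hb : theta1 b τ = 0) :
    IsOddQuartic τ fun z => ((periods τ hτ).derivWeierstrassP (z - b) +
      (periods τ hτ).derivWeierstrassP (z + b)) * theta1 z τ ^ 4 where
  differentiable := by
    have h := (differentiable_derivWeierstrassP_mul hτ hb).add
      (differentiable_derivWeierstrassP_mul hτ (b := -b) (by rw [theta1_neg, hb, neg_zero]))
    convert! h using 1
    ext z
    simp only [Pi.add_apply, sub_neg_eq_add]
    ring
  neg z := by
    rw [theta1_neg, ← neg_add', PeriodPair.derivWeierstrassP_neg,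
      show -z + b = -(z - b) by ring, PeriodPair.derivWeierstrassP_neg]
    ring
  add_pi z := by
    have h := fun w => (periods τ hτ).derivWeierstrassP_add_coe w ⟨_, pi_mem_lattice hτ⟩
    rw [theta1_add_pi, add_sub_right_comm, add_right_comm, h, h]
    ring
  add_pi_mul z := by
    have h := fun w => (periods τ hτ).derivWeierstrassP_add_coe w ⟨_, pi_mul_mem_lattice hτ⟩
    rw [theta1_add_pi_mul_pow_four, add_sub_right_comm, add_right_comm, h, h]
    ring

lemma tendsto_cube_mul_derivWeierstrassP (L : PeriodPair) :
    Filter.Tendsto (fun z => z ^ 3 * L.derivWeierstrassP z) (nhdsWithin 0 {0}ᶜ) (nhds (-2)) := by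
  have h1 : Filter.Tendsto (fun z => z ^ 3 * L.derivWeierstrassPExcept 0 z - 2)
      (nhdsWithin 0 {0}ᶜ) (nhds (-2)) := by
    have : ContinuousAt (fun z => z ^ 3 * L.derivWeierstrassPExcept 0 z - 2) 0 :=
      ((continuousAt_id.pow 3).mul
        (L.analyticAt_derivWeierstrassPExcept 0).continuousAt).sub continuousAt_const
    have h := this.tendsto.mono_left (nhdsWithin_le_nhds (s := {0}ᶜ))
    simpa using h
  refine h1.congr' ?_
  filter_upwards [self_mem_nhdsWithin] with z hz
  rw [← L.derivWeierstrassPExcept_sub 0]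
  have : z ≠ 0 := hz
  simp only [ZeroMemClass.coe_zero, sub_zero]
  field_simp

/-- `θ₁'` does not vanish, and `℘'(z) θ₁(z)⁴ = -θ₁'³ θ₁(2z)` for every `z`. -/
lemma derivWeierstrassP_mul_theta1 (hτ : 0 < τ.im) :
    theta1' τ ≠ 0 ∧ ∀ z, (periods τ hτ).derivWeierstrassP z * theta1 z τ ^ 4 =
      -theta1' τ ^ 3 * theta1 (2 * z) τ := by
  set L := periods τ hτ
  obtain ⟨w, hw⟩ := exists_theta1_ne_zero hτ
  obtain ⟨c, hc⟩ := (isOddQuartic_derivWeierstrassP hτ (theta1_zero τ)).exists_eq_const_mul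
    (isOddQuartic_theta1_two_mul hτ)
    (fun h => hw (by simpa [mul_div_cancel₀] using congrFun h (w / 2)))
  have hc' : ∀ z, L.derivWeierstrassP z * theta1 z τ ^ 4 = c / 2 * theta1 (2 * z) τ := fun z => by
    have := hc z
    rw [sub_zero, add_zero] at this
    linear_combination this / 2
  have han : AnalyticAt ℂ (fun z => theta1 z τ) 0 := (differentiable_theta1 hτ).analyticAt 0
  have hne := theta1_eventually_ne_zero hτ 0
  obtain ⟨m, g, hg, hg0, hgz⟩ := han.exists_eventuallyEq_pow_smul_nonzero_iff.mpr fun h =>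
    (hne.and (h.filter_mono nhdsWithin_le_nhds)).exists.elim fun _ hz => hz.1 hz.2
  simp only [sub_zero, smul_eq_mul] at hgz
  have hm0 : m ≠ 0 := by
    rintro rfl
    have := hgz.self_of_nhds
    rw [theta1_zero, pow_zero, one_mul] at this
    exact hg0 this.symm
  obtain ⟨k, rfl⟩ := Nat.exists_eq_succ_of_ne_zero hm0
  have h2 : Filter.Tendsto (fun z : ℂ => 2 * z) (nhds 0) (nhds 0) :=
    (continuous_const_mul 2).tendsto' _ _ (by simp)
  have hev : ∀ᶠ z in nhdsWithin (0 : ℂ) {0}ᶜ,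
      z ^ 3 * L.derivWeierstrassP z * (z ^ (3 * k) * g z ^ 4) =
        c / 2 * (2 ^ (k + 1) * g (2 * z)) := by
    filter_upwards [hgz.filter_mono nhdsWithin_le_nhds,
      (h2.eventually hgz).filter_mono nhdsWithin_le_nhds, self_mem_nhdsWithin] with z h3 h4 hz
    have h5 := hc' z
    rw [h3, h4] at h5
    have hz0 : z ≠ 0 := hz
    refine mul_left_cancel₀ (pow_ne_zero (k + 1) hz0) ?_
    rw [mul_pow, Nat.succ_eq_add_one] at h5
    linear_combination h5
  have hgt : Filter.Tendsto g (nhdsWithin 0 {0}ᶜ) (nhds (g 0)) :=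
    hg.continuousAt.tendsto.mono_left nhdsWithin_le_nhds
  have hgt2 : Filter.Tendsto (fun z => g (2 * z)) (nhdsWithin 0 {0}ᶜ) (nhds (g 0)) :=
    (hg.continuousAt.tendsto.comp h2).mono_left nhdsWithin_le_nhds
  have hpow : Filter.Tendsto (fun z : ℂ => z ^ (3 * k)) (nhdsWithin 0 {0}ᶜ)
      (nhds (0 ^ (3 * k))) :=
    (continuous_pow (3 * k)).continuousAt.tendsto.mono_left nhdsWithin_le_nhds
  have hlim := tendsto_nhds_unique
    (((tendsto_cube_mul_derivWeierstrassP L).mul (hpow.mul (hgt.pow 4))).congr' hev)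
    ((hgt2.const_mul (2 ^ (k + 1))).const_mul (c / 2))
  have hk : k = 0 := by
    by_contra hk
    rw [zero_pow (by omega), zero_mul, mul_zero, eq_comm, mul_eq_zero, or_iff_left
      (mul_ne_zero (pow_ne_zero _ two_ne_zero) hg0)] at hlim
    have hz : ∀ᶠ z in nhdsWithin (0 : ℂ) {0}ᶜ, z ^ 3 * L.derivWeierstrassP z = 0 := by
      filter_upwards [hne] with z hz
      have h5 := hc' z
      rw [hlim, zero_mul, mul_eq_zero, or_iff_left (pow_ne_zero 4 hz)] at h5
      rw [h5, mul_zero]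
    have := tendsto_nhds_unique ((tendsto_cube_mul_derivWeierstrassP L).congr' hz)
      tendsto_const_nhds
    norm_num at this
  subst hk
  have hd : theta1' τ = g 0 := by
    have h6 : HasDerivAt (fun z => z * g z) (1 * g 0 + 0 * deriv g 0) 0 :=
      (hasDerivAt_id (0 : ℂ)).mul hg.differentiableAt.hasDerivAt
    rw [theta1', Filter.EventuallyEq.deriv_eq (f := fun z => z * g z)
      (hgz.mono fun z hz => by simpa using hz), h6.deriv]
    ring
  rw [hd]
  have hc3 : c / 2 = -g 0 ^ 3 := by
    refine mul_right_cancel₀ hg0 ?_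
    simp only [mul_zero, pow_zero, zero_add, pow_one, one_mul] at hlim
    linear_combination -hlim / 2
  exact ⟨hg0, fun z => by rw [hc', hc3]⟩

lemma theta1_ne_zero_of_notMem_lattice (hτ : 0 < τ.im) {a : ℂ}
    (ha : a ∉ (periods τ hτ).lattice) : theta1 a τ ≠ 0 := by
  intro ha0
  set L := periods τ hτ
  obtain ⟨hθ', hmain⟩ := derivWeierstrassP_mul_theta1 hτ
  obtain ⟨w, hw⟩ := exists_theta1_ne_zero hτ
  obtain ⟨c, hc⟩ := (isOddQuartic_derivWeierstrassP hτ ha0).exists_eq_const_mul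
    (isOddQuartic_theta1_two_mul hτ)
    (fun h => hw (by simpa [mul_div_cancel₀] using congrFun h (w / 2)))
  obtain ⟨d, hd⟩ : ∃ d, ∀ z, theta1 z τ ≠ 0 →
      L.derivWeierstrassP (z - a) + L.derivWeierstrassP (z + a) = d * L.derivWeierstrassP z := by
    refine ⟨-(c / theta1' τ ^ 3), fun z hz => mul_right_cancel₀ (pow_ne_zero 4 hz) ?_⟩
    rw [mul_assoc, hmain, hc]
    field_simp
  have hsub : Filter.Tendsto (fun z : ℂ => z - a) (nhdsWithin a {a}ᶜ) (nhdsWithin 0 {0}ᶜ) := by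
    refine tendsto_nhdsWithin_iff.mpr ⟨?_, ?_⟩
    · exact ((continuous_sub_right a).tendsto' a 0 (sub_self a)).mono_left nhdsWithin_le_nhds
    · filter_upwards [self_mem_nhdsWithin] with z hz
      exact sub_ne_zero.mpr hz
  have hpole := (tendsto_cube_mul_derivWeierstrassP L).comp hsub
  have hvanish : ∀ b : ℂ, b ∉ L.lattice → ∀ f : ℂ → ℂ, Continuous f → f a = b →
      Filter.Tendsto (fun z => (z - a) ^ 3 * L.derivWeierstrassP (f z)) (nhdsWithin a {a}ᶜ)
        (nhds 0) := by
    rintro b hb f hf rfl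
    have h : ContinuousAt (fun z => (z - a) ^ 3 * L.derivWeierstrassP (f z)) a :=
      ((continuous_sub_right a).pow 3).continuousAt.mul
        ((L.analyticOnNhd_derivWeierstrassP _ hb).continuousAt.comp' hf.continuousAt)
    have h' := h.tendsto.mono_left (nhdsWithin_le_nhds (s := {a}ᶜ))
    simpa using h'
  have hrhs := (hvanish a ha id continuous_id rfl).const_mul d
  have hne := theta1_eventually_ne_zero hτ a
  by_cases h2 : a + a ∈ L.lattice
  · have hev : ∀ᶠ z in nhdsWithin a {a}ᶜ, d * ((z - a) ^ 3 * L.derivWeierstrassP (id z)) =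
        2 * ((z - a) ^ 3 * L.derivWeierstrassP (z - a)) := by
      filter_upwards [hne] with z hz
      have h := hd z hz
      have hp := L.derivWeierstrassP_add_coe (z - a) ⟨a + a, h2⟩
      rw [show z - a + (a + a) = z + a by ring] at hp
      rw [hp] at h
      simp only [id]
      linear_combination -(z - a) ^ 3 * h
    have := tendsto_nhds_unique (hrhs.congr' hev) (hpole.const_mul 2)
    norm_num at this
  · have hev : ∀ᶠ z in nhdsWithin a {a}ᶜ, d * ((z - a) ^ 3 * L.derivWeierstrassP (id z)) =
        (z - a) ^ 3 * L.derivWeierstrassP (z - a) +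
          (z - a) ^ 3 * L.derivWeierstrassP (z + a) := by
      filter_upwards [hne] with z hz
      simp only [id]
      linear_combination -(z - a) ^ 3 * hd z hz
    have := tendsto_nhds_unique (hrhs.congr' hev)
      (hpole.add (hvanish _ h2 (fun z => z + a) (continuous_add_const a) rfl))
    norm_num at this

end Weierstrass

theorem statement3 (τ : ℂ) (hτ : 0 < τ.im) (x : ℂ) (hx : x ∉ Lambda τ) :
    deriv (wp τ) x = -theta1' τ ^ 3 * theta1 (2 * x) τ / theta1 x τ ^ 4 := by
  have hθ : theta1 x τ ≠ 0 :=
    theta1_ne_zero_of_notMem_lattice hτ ((mem_periods_lattice hτ x).not.mpr hx)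
  rw [wp_eq_weierstrassP hτ, PeriodPair.deriv_weierstrassP, eq_div_iff (pow_ne_zero 4 hθ)]
  exact (derivWeierstrassP_mul_theta1 hτ).2 x
end Liu
end
end

section
/- (Kiepert's quintuple product identity.) For every z ∈ ℂ with θ₁(z|τ) ≠ 0 one has 2 ∑_{n∈ℤ} (−1)ⁿ q^{n(3n+1)/2} cos((6n+1)z) = (∏_{n=1}^∞ (1−qⁿ)) · θ₁(2z|τ)/θ₁(z|τ). -/
noncomputable section

open Complex

namespace Liu

theorem summable_norm_quadratic_exponent {τ : ℂ} (hτ : 0 < τ.im) (z : ℂ) {a : ℤ} (ha : 0 < a)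
    (b c d e : ℤ) :
    Summable fun n : ℤ =>
      ‖exp (Real.pi * I * τ) ^ (a * n ^ 2 + b * n + c) * exp (I * z) ^ (d * n + e)‖ := by
  have hpi : (Real.pi : ℂ) ≠ 0 := by exact_mod_cast Real.pi_ne_zero
  have h := (summable_jacobiTheta₂_term_iff (b * τ / 2 + d * z / (2 * Real.pi)) (a * τ)).2 (by
    have : ((a : ℂ) * τ).im = a * τ.im := by simp
    rw [this]
    positivity)
  refine ((h.mul_left (exp (Real.pi * I * τ * c + I * z * e))).norm).congr fun n => ?_
  rw [jacobiTheta₂_term, ← exp_int_mul, ← exp_int_mul, ← exp_add, ← exp_add]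
  congr 2
  push_cast
  field_simp
  ring

theorem tsum_int_even_add_odd {f : ℤ → ℂ} (hf : Summable f) :
    ∑' n, f (2 * n) + ∑' n, f (2 * n + 1) = ∑' n, f n := by
  have h0 : Function.Injective fun n : ℤ => 2 * n := fun a b h => by simpa using h
  have h1 : Function.Injective fun n : ℤ => 2 * n + 1 := fun a b h => by simpa using h
  have e := (hf.comp_injective h0).hasSum
  have o := (hf.comp_injective h1).hasSum
  have hc : IsCompl (Set.range fun n : ℤ => 2 * n) (Set.range fun n : ℤ => 2 * n + 1) := by
    rw [← compl_eq_iff_isCompl]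
    ext n
    simp only [Set.mem_compl_iff, Set.mem_range, not_exists]
    constructor
    · intro h
      exact ⟨n / 2, by have := h (n / 2); omega⟩
    · rintro ⟨m, rfl⟩ k
      omega
  exact ((h0.hasSum_range_iff.2 e).add_isCompl hc (h1.hasSum_range_iff.2 o)).tsum_eq.symm

theorem tsum_zpow_shift {p : ℂ} {f g : ℤ → ℤ} (c : ℤ) (h : ∀ n, f n = g (n + c)) :
    ∑' n, p ^ f n = ∑' n, p ^ g n := by
  simp_rw [h]
  exact (Equiv.addRight c).tsum_eq fun n => p ^ g n

theorem tsum_zpow_neg_shift {p : ℂ} {f g : ℤ → ℤ} (c : ℤ) (h : ∀ n, f n = g (c - n)) :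
    ∑' n, p ^ f n = ∑' n, p ^ g n := by
  simp_rw [h]
  exact (Equiv.subLeft c).tsum_eq fun n => p ^ g n

theorem summable_pentagonal_mul_zpow {τ : ℂ} (hτ : 0 < τ.im) (z : ℂ) {p w : ℂ}
    (hp : p = exp (Real.pi * I * τ)) (hw : w = exp (I * z)) (d e : ℤ) :
    Summable fun n : ℤ => (-1) ^ n * p ^ (n * (3 * n + 1)) * w ^ (d * n + e) := by
  refine Summable.of_norm ((summable_norm_quadratic_exponent hτ z
    (a := 3) (by norm_num) 1 0 d e).congr fun n => ?_)
  rw [← hp, ← hw, mul_assoc, norm_mul ((-1 : ℂ) ^ n), norm_zpow (-1 : ℂ),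
    show 3 * n ^ 2 + 1 * n + 0 = n * (3 * n + 1) by ring]
  simp

theorem summable_pentagonal {τ : ℂ} (hτ : 0 < τ.im) {p : ℂ} (hp : p = exp (Real.pi * I * τ)) :
    Summable fun n : ℤ => (-1) ^ n * p ^ (n * (3 * n + 1)) := by
  simpa using summable_pentagonal_mul_zpow hτ 0 hp rfl 0 0

theorem tsum_pentagonal_even_sub_odd {τ : ℂ} (hτ : 0 < τ.im) {p : ℂ} (hp : p = exp (Real.pi * I * τ)) :
    ∑' n : ℤ, (-1) ^ n * p ^ (n * (3 * n + 1)) =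
      ∑' n : ℤ, p ^ (12 * n ^ 2 - 2 * n) - ∑' n : ℤ, p ^ (12 * n ^ 2 + 10 * n + 2) := by
  have hs := summable_pentagonal hτ hp
  rw [← tsum_int_even_add_odd hs, sub_eq_add_neg, ← tsum_neg]
  congr 1
  · rw [← tsum_zpow_neg_shift (f := fun n => 2 * n * (3 * (2 * n) + 1)) 0 (fun n => by ring)]
    refine tsum_congr fun n => ?_
    rw [(even_two_mul n).neg_one_zpow, one_mul]
  · rw [tsum_neg, ← tsum_zpow_neg_shift
      (f := fun n => (2 * n + 1) * (3 * (2 * n + 1) + 1)) (-1) (fun n => by ring), ← tsum_neg]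
    refine tsum_congr fun n => ?_
    rw [(odd_two_mul_add_one n).neg_one_zpow, neg_one_mul]

/-- The coefficients, in the product of the theta series, of even powers of `w²` cancel. -/
theorem even_coeff_cancel {p : ℂ} (j : ℤ) :
    ∑' n : ℤ, p ^ (12 * n ^ 2 + 4 * n + 6 * n * (2 * j) + (2 * j) * (2 * j + 1)) =
      ∑' n : ℤ, p ^ (12 * n ^ 2 + 4 * n - 6 * n * (2 * j) + (2 * j) * (2 * j - 1)) :=
  tsum_zpow_shift j fun n => by ring

theorem odd_coeff_eq {p : ℂ} (hp : p ≠ 0) (j : ℤ) :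
    ∑' n : ℤ, p ^ (12 * n ^ 2 + 4 * n - 6 * n * (2 * j + 1) + (2 * j + 1) * (2 * j)) -
      ∑' n : ℤ, p ^ (12 * n ^ 2 + 4 * n + 6 * n * (2 * j + 1) + (2 * j + 1) * (2 * j + 2)) =
    (-1) ^ j * p ^ (j * (j + 1)) *
      (∑' n : ℤ, p ^ (12 * n ^ 2 - 2 * n) - ∑' n : ℤ, p ^ (12 * n ^ 2 + 10 * n + 2)) := by
  have key (g : ℤ → ℤ) : p ^ (j * (j + 1)) * ∑' n, p ^ g n = ∑' n, p ^ (j * (j + 1) + g n) := by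
    simp_rw [← tsum_mul_left, ← zpow_add₀ hp]
  rw [mul_sub, mul_assoc, mul_assoc, key, key]
  obtain ⟨l, rfl | rfl⟩ := Int.even_or_odd' j
  · rw [(even_two_mul l).neg_one_zpow, one_mul, one_mul]
    congr 1
    · exact tsum_zpow_shift (-l) fun n => by ring
    · exact tsum_zpow_shift l fun n => by ring
  · rw [(odd_two_mul_add_one l).neg_one_zpow, neg_one_mul, neg_one_mul, neg_sub_neg]
    congr 1
    · exact tsum_zpow_shift (-l - 1) fun n => by ring
    · exact tsum_zpow_shift (l + 1) fun n => by ring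

/-- The unimodular affine change of variables `(k, n) ↦ (n, k + c n + d)`. -/
def shearEquiv (c d : ℤ) : ℤ × ℤ ≃ ℤ × ℤ where
  toFun x := (x.2, x.1 + c * x.2 + d)
  invFun y := (y.2 - c * y.1 - d, y.1)
  left_inv x := by ext <;> dsimp only; ring
  right_inv y := by ext <;> dsimp only; ring

theorem quintuple_zpow {τ : ℂ} (hτ : 0 < τ.im) (z : ℂ) {p w : ℂ}
    (hp : p = exp (Real.pi * I * τ)) (hw : w = exp (I * z)) :
    (∑' n : ℤ, (-1) ^ n * p ^ (n * (3 * n + 1)) * w ^ (6 * n + 1) +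
        ∑' n : ℤ, (-1) ^ n * p ^ (n * (3 * n + 1)) * w ^ (-(6 * n + 1))) *
      ∑' m : ℤ, (-1) ^ m * p ^ (m * (m + 1)) * w ^ (2 * m + 1) =
    (∑' n : ℤ, (-1) ^ n * p ^ (n * (3 * n + 1))) *
      ∑' m : ℤ, (-1) ^ m * p ^ (m * (m + 1)) * w ^ (4 * m + 2) := by
  have hp0 : p ≠ 0 := hp ▸ exp_ne_zero _
  have hw0 : w ≠ 0 := hw ▸ exp_ne_zero _
  have hsum (a b d e : ℤ) (ha : 0 < a) (E D : ℤ → ℤ) (hE : ∀ n, E n = a * n ^ 2 + b * n + 0)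
      (hD : ∀ n, D n = d * n + e) : Summable fun n : ℤ => ‖(-1 : ℂ) ^ n * p ^ E n * w ^ D n‖ := by
    refine (summable_norm_quadratic_exponent hτ z ha b 0 d e).congr fun n => ?_
    rw [← hp, ← hw, mul_assoc, norm_mul ((-1 : ℂ) ^ n), norm_zpow (-1 : ℂ), hE, hD]
    simp
  have hA := hsum 3 1 6 1 (by norm_num) (fun n => n * (3 * n + 1)) (fun n => 6 * n + 1)
    (fun n => by ring) (fun n => by ring)
  have hB := hsum 3 1 (-6) (-1) (by norm_num) (fun n => n * (3 * n + 1)) (fun n => -(6 * n + 1))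
    (fun n => by ring) (fun n => by ring)
  have hT := hsum 1 1 2 1 (by norm_num) (fun n => n * (n + 1)) (fun n => 2 * n + 1)
    (fun n => by ring) (fun n => by ring)
  have h1 := (shearEquiv (-3) (-1)).summable_iff.2 (summable_mul_of_summable_norm hA hT)
  have h2 := (shearEquiv 3 0).summable_iff.2 (summable_mul_of_summable_norm hB hT)
  rw [add_mul, tsum_mul_tsum_of_summable_norm hA hT, tsum_mul_tsum_of_summable_norm hB hT,
    ← (shearEquiv (-3) (-1)).tsum_eq (fun x : ℤ × ℤ => (-1) ^ x.1 * p ^ (x.1 * (3 * x.1 + 1)) *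
      w ^ (6 * x.1 + 1) * ((-1) ^ x.2 * p ^ (x.2 * (x.2 + 1)) * w ^ (2 * x.2 + 1))),
    ← (shearEquiv 3 0).tsum_eq (fun x : ℤ × ℤ => (-1) ^ x.1 * p ^ (x.1 * (3 * x.1 + 1)) *
      w ^ (-(6 * x.1 + 1)) * ((-1) ^ x.2 * p ^ (x.2 * (x.2 + 1)) * w ^ (2 * x.2 + 1)))]
  refine (h1.tsum_add h2).symm.trans ?_
  rw [    (h1.add h2).tsum_prod]
  have inner (k : ℤ) : ∑' n : ℤ,
      (((-1) ^ n * p ^ (n * (3 * n + 1)) * w ^ (6 * n + 1)) *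
        ((-1) ^ (k + -3 * n + -1) * p ^ ((k + -3 * n + -1) * (k + -3 * n + -1 + 1)) *
          w ^ (2 * (k + -3 * n + -1) + 1)) +
      ((-1) ^ n * p ^ (n * (3 * n + 1)) * w ^ (-(6 * n + 1))) *
        ((-1) ^ (k + 3 * n + 0) * p ^ ((k + 3 * n + 0) * (k + 3 * n + 0 + 1)) *
          w ^ (2 * (k + 3 * n + 0) + 1))) =
      (-1) ^ k * w ^ (2 * k) * (∑' n : ℤ, p ^ (12 * n ^ 2 + 4 * n + 6 * n * k + k * (k + 1)) -
        ∑' n : ℤ, p ^ (12 * n ^ 2 + 4 * n - 6 * n * k + k * (k - 1))) := by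
    have s (b c : ℤ) (E : ℤ → ℤ) (hE : ∀ n, E n = 12 * n ^ 2 + b * n + c) :
        Summable fun n : ℤ => p ^ E n := by
      refine Summable.of_norm
        ((summable_norm_quadratic_exponent hτ z (by norm_num : (0 : ℤ) < 12) b c 0 0).congr
          fun n => ?_)
      simp [hp, hE]
    rw [← Summable.tsum_sub (s (4 + 6 * k) (k * (k + 1)) _ fun n => by ring)
      (s (4 - 6 * k) (k * (k - 1)) _ fun n => by ring), ← tsum_mul_left]
    refine tsum_congr fun n => ?_
    have sgn1 : (-1 : ℂ) ^ n * (-1) ^ (k + -3 * n + -1) = -(-1) ^ k := by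
      rw [← zpow_add₀ (by norm_num), show n + (k + -3 * n + -1) = k + (2 * (-n - 1) + 1) by ring,
        zpow_add₀ (by norm_num), (odd_two_mul_add_one _).neg_one_zpow, mul_neg_one]
    have sgn2 : (-1 : ℂ) ^ n * (-1) ^ (k + 3 * n + 0) = (-1) ^ k := by
      rw [← zpow_add₀ (by norm_num), show n + (k + 3 * n + 0) = k + 2 * (2 * n) by ring,
        zpow_add₀ (by norm_num), (even_two_mul _).neg_one_zpow, mul_one]
    have rearr (a b c a' b' c' : ℂ) : a * b * c * (a' * b' * c') = a * a' * (b * b') * (c * c') := by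
      ring
    rw [rearr, rearr, sgn1, sgn2, ← zpow_add₀ hp0, ← zpow_add₀ hp0, ← zpow_add₀ hw0,
      ← zpow_add₀ hw0,
      show 6 * n + 1 + (2 * (k + -3 * n + -1) + 1) = 2 * k by ring,
      show -(6 * n + 1) + (2 * (k + 3 * n + 0) + 1) = 2 * k by ring,
      show n * (3 * n + 1) + (k + -3 * n + -1) * (k + -3 * n + -1 + 1) =
        12 * n ^ 2 + 4 * n - 6 * n * k + k * (k - 1) by ring,
      show n * (3 * n + 1) + (k + 3 * n + 0) * (k + 3 * n + 0 + 1) =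
        12 * n ^ 2 + 4 * n + 6 * n * k + k * (k + 1) by ring]
    ring
  refine (tsum_congr inner).trans ?_
  have hinj : Function.Injective fun n : ℤ => 2 * n + 1 := fun a b h => by simpa using h
  rw [← hinj.tsum_eq, tsum_pentagonal_even_sub_odd hτ hp, ← tsum_mul_left]
  · refine tsum_congr fun j => ?_
    have h := odd_coeff_eq hp0 j
    rw [(odd_two_mul_add_one j).neg_one_zpow, show 2 * (2 * j + 1) = 4 * j + 2 by ring,
      add_assoc (2 * j) 1 1, add_sub_cancel_right, one_add_one_eq_two]
    linear_combination w ^ (4 * j + 2) * h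
  · intro k hk
    obtain ⟨j, rfl | rfl⟩ := Int.even_or_odd' k
    · refine absurd ?_ hk
      beta_reduce
      rw [even_coeff_cancel, sub_self, mul_zero]
    · exact ⟨j, rfl⟩

theorem hasSum_pentagonal_tprod_one_sub_pow {x : ℂ} (hx : ‖x‖ < 1) :
    HasSum (fun k : ℕ => (-1) ^ k * (x ^ pentagonal (-k) - x ^ pentagonal (k + 1)))
      (∏' n : ℕ, (1 - x ^ (n + 1))) := by
  set r := ‖x‖ with hr
  have hr0 : 0 ≤ r := norm_nonneg x
  have hgeo := summable_geometric_of_lt_one hr0 hx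
  have hprod (k n : ℕ) : ‖∏ i ∈ Finset.range n, (1 - x ^ (k + i + 1))‖ ≤
      Real.exp (∑' i, r ^ i) := by
    rw [norm_prod]
    calc ∏ i ∈ Finset.range n, ‖1 - x ^ (k + i + 1)‖
        ≤ ∏ i ∈ Finset.range n, (1 + r ^ i) := by
          refine Finset.prod_le_prod (fun _ _ => norm_nonneg _) fun i _ => ?_
          refine (norm_sub_le _ _).trans ?_
          rw [norm_one, norm_pow]
          gcongr 1 + ?_
          exact pow_le_pow_of_le_one hr0 hx.le (by omega)
      _ ≤ Real.exp (∑ i ∈ Finset.range n, r ^ i) :=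
          Real.prod_one_add_le_exp_sum _ fun i => pow_nonneg hr0 i
      _ ≤ Real.exp (∑' i, r ^ i) :=
          Real.exp_le_exp.2 (hgeo.sum_le_tsum _ fun i _ => pow_nonneg hr0 i)
  have hterm (k n : ℕ) : ‖x ^ ((k + 1) * n) * ∏ i ∈ Finset.range (n + 1), (1 - x ^ (k + i + 1))‖ ≤
      r ^ n * Real.exp (∑' i, r ^ i) := by
    rw [norm_mul, norm_pow]
    gcongr ?_ * ?_
    · exact pow_le_pow_of_le_one hr0 hx.le (Nat.le_mul_of_pos_left n k.succ_pos)
    · exact hprod k (n + 1)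
  have hbound := hgeo.mul_right (Real.exp (∑' i, r ^ i))
  have hpow {f : ℕ → ℕ} (hf : ∀ k, k ≤ f k) : Summable fun k => x ^ f k :=
    hgeo.of_norm_bounded fun k => by
      rw [norm_pow]
      exact pow_le_pow_of_le_one hr0 hx.le (hf k)
  have hrhs : Summable fun k : ℕ => (-1) ^ k * (x ^ pentagonal (-k) - x ^ pentagonal (k + 1)) := by
    refine Summable.of_norm ((((hpow (f := fun k : ℕ => pentagonal (-k)) fun k => ?_).sub
      (hpow (f := fun k : ℕ => pentagonal (k + 1)) fun k => ?_)).norm).congr fun k => ?_)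
    · have := two_mul_natCast_pentagonal_neg k
      zify
      nlinarith
    · have := two_mul_natCast_pentagonal (k + 1)
      zify
      nlinarith
    · simp
  have hlhs (k : ℕ) : Multipliable fun n : ℕ => 1 - x ^ (n + k + 1) := by
    simp_rw [sub_eq_add_neg]
    refine multipliable_one_add_of_summable ?_
    simp_rw [norm_neg]
    exact (hpow (f := fun n => n + k + 1) fun n => by omega).norm
  rw [Pentagonal.tprod_one_sub_pow (tendsto_pow_atTop_nhds_zero_of_norm_lt_one hx)
    (fun k => hbound.of_norm_bounded (hterm k)) hlhs hrhs ?_]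
  · exact hrhs.hasSum
  · refine squeeze_zero_norm (a := fun k => r ^ k * ∑' n, r ^ n * Real.exp (∑' i, r ^ i))
      (fun k => ?_) ?_
    · rw [norm_mul, norm_mul, norm_pow, norm_neg, norm_one, one_pow, one_mul, norm_pow]
      gcongr ?_ * ?_
      · refine pow_le_pow_of_le_one hr0 hx.le ?_
        rw [Nat.le_div_iff_mul_le two_pos]
        nlinarith
      · exact tsum_of_norm_bounded hbound.hasSum (hterm k)
    · simpa using (tendsto_pow_atTop_nhds_zero_of_lt_one hr0 hx).mul_const
        (∑' n, r ^ n * Real.exp (∑' i, r ^ i))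

theorem tsum_int_eq_tsum_nat_add {f : ℤ → ℂ} (hf : Summable f) :
    ∑' n, f n = ∑' k : ℕ, (f k + f (-(k + 1))) := by
  have e : Summable fun k : ℕ => f k := hf.comp_injective Nat.cast_injective
  have o : Summable fun k : ℕ => f (-(k + 1)) :=
    hf.comp_injective (i := fun k : ℕ => -((k : ℤ) + 1)) fun a b h => by simpa using h
  rw [tsum_of_nat_of_neg_add_one e o, e.tsum_add o]

theorem tprod_one_sub_sq_pow_eq_tsum {p : ℂ} (hp : ‖p‖ < 1)
    (hs : Summable fun n : ℤ => (-1) ^ n * p ^ (n * (3 * n + 1))) :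
    ∏' n : ℕ, (1 - (p ^ 2) ^ (n + 1)) = ∑' n : ℤ, (-1) ^ n * p ^ (n * (3 * n + 1)) := by
  have hx : ‖p ^ 2‖ < 1 := by
    rw [norm_pow]
    exact pow_lt_one₀ (norm_nonneg p) hp two_ne_zero
  rw [← (hasSum_pentagonal_tprod_one_sub_pow hx).tsum_eq, tsum_int_eq_tsum_nat_add hs]
  refine tsum_congr fun k => ?_
  have hpow (m : ℕ) : (p ^ 2) ^ m = p ^ (2 * (m : ℤ)) := by
    rw [← pow_mul, ← zpow_natCast]
    push_cast
    rfl
  rw [hpow, hpow, two_mul_natCast_pentagonal_neg, two_mul_natCast_pentagonal, mul_sub,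
    zpow_neg, zpow_add_one₀ (by norm_num), zpow_natCast, mul_neg_one, inv_neg, neg_mul,
    ← sub_eq_add_neg, ← inv_pow, inv_neg_one]
  congr 3
  ring

theorem statement8 (τ : ℂ) (hτ : 0 < τ.im) (z : ℂ) (hz : theta1 z τ ≠ 0) :
    2 * ∑' n : ℤ, (-1 : ℂ) ^ n * exp (piC * I * τ * (n : ℂ) * (3 * (n : ℂ) + 1)) *
        cos ((6 * (n : ℂ) + 1) * z) =
      (∏' n : ℕ, (1 - qq τ ^ (n + 1))) * theta1 (2 * z) τ / theta1 z τ := by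
  set p := exp (Real.pi * I * τ) with hp
  set w := exp (I * z) with hw
  have hp1 : ‖p‖ < 1 := by
    rw [hp, norm_exp, Real.exp_lt_one_iff]
    have : ((Real.pi : ℂ) * I * τ).re = -(Real.pi * τ.im) := by simp
    rw [this, neg_lt_zero]
    positivity
  have hq : qq τ = p ^ 2 := by
    rw [qq, piC, hp, ← exp_nat_mul]
    congr 1
    push_cast
    ring
  have hpow (a : ℤ) (b : ℂ) (h : b = a * (Real.pi * I * τ)) : exp b = p ^ a := by
    rw [h, hp, exp_int_mul]
  have hwpow (a : ℤ) (b : ℂ) (h : b = a * (I * z)) : exp b = w ^ a := by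
    rw [h, hw, exp_int_mul]
  have hθ : theta1 z τ = -I * exp (piC * I * τ / 4) *
      ∑' m : ℤ, (-1) ^ m * p ^ (m * (m + 1)) * w ^ (2 * m + 1) := by
    rw [theta1]
    congr 1
    refine tsum_congr fun m => ?_
    congr 2
    · exact hpow _ _ (by rw [piC]; push_cast; ring)
    · exact hwpow _ _ (by push_cast; ring)
  have hθ2 : theta1 (2 * z) τ = -I * exp (piC * I * τ / 4) *
      ∑' m : ℤ, (-1) ^ m * p ^ (m * (m + 1)) * w ^ (4 * m + 2) := by
    rw [theta1]
    congr 1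
    refine tsum_congr fun m => ?_
    congr 2
    · exact hpow _ _ (by rw [piC]; push_cast; ring)
    · exact hwpow _ _ (by push_cast; ring)
  have hA := summable_pentagonal_mul_zpow hτ z hp hw 6 1
  have hB := summable_pentagonal_mul_zpow hτ z hp hw (-6) (-1)
  have hsum : 2 * ∑' n : ℤ, (-1 : ℂ) ^ n * exp (piC * I * τ * (n : ℂ) * (3 * (n : ℂ) + 1)) *
      cos ((6 * (n : ℂ) + 1) * z) =
      ∑' n : ℤ, (-1) ^ n * p ^ (n * (3 * n + 1)) * w ^ (6 * n + 1) +
        ∑' n : ℤ, (-1) ^ n * p ^ (n * (3 * n + 1)) * w ^ (-(6 * n + 1)) := by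
    simp_rw [neg_add, ← neg_mul]
    rw [← hA.tsum_add hB, ← tsum_mul_left]
    refine tsum_congr fun n => ?_
    rw [cos, hpow (n * (3 * n + 1)) _ (by rw [piC]; push_cast; ring),
      hwpow (6 * n + 1) _ (by push_cast; ring), hwpow (-6 * n + -1) _ (by push_cast; ring)]
    ring
  rw [eq_div_iff hz, hsum, hθ, hθ2, hq,
    tprod_one_sub_sq_pow_eq_tsum hp1 (summable_pentagonal hτ hp)]
  linear_combination -I * exp (piC * I * τ / 4) * quintuple_zpow hτ z hp hw
end Liu
end
end
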